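/- The encoding of session types into linear π-types commutes with duality: for every session type S, ⟦dual(S)⟧ = overline(⟦S⟧), where overline swaps the input and output capabilities of the outermost linear channel type. In particular the encodings of a session type and of its dual are linear channel types carrying the same payload types and having dual outermost capabilities. -/

import Mathlib

/-! Session types and standard linear π-types, duality, encoding. -/

namespace SessionPi

mutual
/-- Session types: `end`, `!T.S`, `?T.S`, select `⊕{lᵢ : Sᵢ}_{i∈I}`, branch `&{lᵢ : Sᵢ}_{i∈I}`.
Labels are natural numbers; the index set `I` is a finite set of labels. -/
inductive SType : Type
  | done : SType                                   -- end
  | send : Ty → SType → SType                      -- !T.S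
  | recv : Ty → SType → SType                      -- ?T.S
  | sel  : (I : Finset ℕ) → (∀ i ∈ I, SType) → SType  -- ⊕{lᵢ : Sᵢ}
  | bra  : (I : Finset ℕ) → (∀ i ∈ I, SType) → SType  -- &{lᵢ : Sᵢ}

/-- Types: session types, standard channel types `#T`, `Unit`. -/
inductive Ty : Type
  | session : SType → Ty
  | chan : Ty → Ty
  | unit : Ty
end

/-- Duality on session types. -/
def dual : SType → SType
  | .done => .done
  | .send T S => .recv T (dual S)
  | .recv T S => .send T (dual S)
  | .sel I f => .bra I (fun i h => dual (f i h))
  | .bra I f => .sel I (fun i h => dual (f i h))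

/-- Linear π-types: `ℓo[t̄]`, `ℓi[t̄]`, `∅[]`, variants, connections `#[t̄]`, `Unit`. -/
inductive PiTy : Type
  | lout : (n : ℕ) → (Fin n → PiTy) → PiTy           -- ℓo[t₁,…,tₙ]
  | lin  : (n : ℕ) → (Fin n → PiTy) → PiTy           -- ℓi[t₁,…,tₙ]
  | noCap : PiTy                                      -- ∅[]
  | variant : (I : Finset ℕ) → (∀ i ∈ I, PiTy) → PiTy -- ⟨lᵢ : tᵢ⟩
  | conn : (n : ℕ) → (Fin n → PiTy) → PiTy            -- #[t₁,…,tₙ]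
  | unit : PiTy

/-- The (partial) involution `overline` swapping the outermost input/output capability. -/
def flipCap : PiTy → PiTy
  | .lin n ts => .lout n ts
  | .lout n ts => .lin n ts
  | t => t

mutual
/-- Encoding of session types into linear π-types:
`⟦end⟧ = ∅[]`, `⟦!T.S⟧ = ℓo[⟦T⟧,⟦dual S⟧]`, `⟦?T.S⟧ = ℓi[⟦T⟧,⟦S⟧]`,
`⟦⊕{lᵢ:Sᵢ}⟧ = ℓo[⟨lᵢ:⟦dual Sᵢ⟧⟩]`, `⟦&{lᵢ:Sᵢ}⟧ = ℓi[⟨lᵢ:⟦Sᵢ⟧⟩]`.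
(`encDS` implements `S ↦ ⟦dual S⟧`; see `encDS_eq` below.) -/
def encS : SType → PiTy
  | .done => .noCap
  | .send T S => .lout 2 ![encTy T, encDS S]
  | .recv T S => .lin 2 ![encTy T, encS S]
  | .sel I f => .lout 1 ![.variant I (fun i h => encDS (f i h))]
  | .bra I f => .lin 1 ![.variant I (fun i h => encS (f i h))]

/-- `encDS S = encS (dual S)` (proved below in `encDS_eq`). -/
def encDS : SType → PiTy
  | .done => .noCap
  | .send T S => .lin 2 ![encTy T, encDS S]
  | .recv T S => .lout 2 ![encTy T, encS S]
  | .sel I f => .lin 1 ![.variant I (fun i h => encDS (f i h))]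
  | .bra I f => .lout 1 ![.variant I (fun i h => encS (f i h))]

/-- Encoding of types, homomorphic on non-session constructs. -/
def encTy : Ty → PiTy
  | .session S => encS S
  | .chan T => .conn 1 ![encTy T]
  | .unit => .unit
end

theorem encDS_eq : ∀ S : SType, encDS S = encS (dual S) ∧ encDS (dual S) = encS S := by
  intro S
  induction S using SType.rec (motive_2 := fun _ => True) with
  | done => simp [encDS, encS, dual]
  | send T S ihT ihS =>
      constructor <;> (simp only [encDS, encS, dual]; rw [ihS.1])
  | recv T S ihT ihS =>
      constructor <;> (simp only [encDS, encS, dual]; rw [ihS.2])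
  | sel I f ih =>
      have h1 : (fun i h => encDS (f i h)) = (fun i h => encS (dual (f i h))) := by
        funext i h; exact (ih i h).1
      constructor <;> (simp only [encDS, encS, dual]; rw [h1])
  | bra I f ih =>
      have h2 : (fun i h => encDS (dual (f i h))) = (fun i h => encS (f i h)) := by
        funext i h; exact (ih i h).2
      constructor <;> (simp only [encDS, encS, dual]; rw [h2])
  | session S ih => trivial
  | chan T ih => trivial
  | unit => trivial

/-- The encoding commutes with duality: `⟦dual S⟧ = overline ⟦S⟧`, where `overline`
swaps the outermost input/output capabilities of a linear channel type. -/
theorem enc_dual_eq_flipCap (S : SType) : encS (dual S) = flipCap (encS S) := by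
  rw [← (encDS_eq S).1]
  cases S <;> simp only [encDS, encS, flipCap]

end SessionPi
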